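/- With the Q-polynomial distance-regular graph setup, let W be an irreducible T-module with endpoint ρ, dual endpoint τ, and diameter d. Then for 0 ≤ h ≤ d and 0 ≤ i,j ≤ D: (i) W^{↓↓}_h ⊆ Ṽ^{↓↓}_{i,j} if and only if i = ρ + h and j = τ + d − h; (ii) W^{↑↓}_h ⊆ Ṽ^{↑↓}_{i,j} if and only if i = D − ρ − d + h and j = τ + d − h; (iii) W^{↓↑}_h ⊆ Ṽ^{↓↑}_{i,j} if and only if i = ρ + h and j = D − τ − h; (iv) W^{↑↑}_h ⊆ Ṽ^{↑↑}_{i,j} if and only if i = D − ρ − d + h and j = D − τ − h. -/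

import Mathlib

noncomputable section

open Matrix Finset
open scoped ComplexInnerProductSpace

/-- A `Q`-polynomial distance-regular graph setup: a finite connected simple graph `G` on `X`
with diameter `D ≥ 3`, intersection numbers `p h i j`, primitive idempotents
`E 0, …, E D` of the Bose–Mesner algebra with (distinct, real) eigenvalues `θ 0, …, θ D`,
and Krein parameters `q h i j` satisfying the `Q`-polynomial condition with respect to the
ordering `E 0, …, E D`. -/
structure QPolyDRG (X : Type*) [Fintype X] [DecidableEq X] where
  G : SimpleGraph X
  conn : G.Connected
  D : ℕ
  hD3 : 3 ≤ D
  dist_le : ∀ y z : X, G.dist y z ≤ D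
  dist_eq : ∃ y z : X, G.dist y z = D
  p : ℕ → ℕ → ℕ → ℕ
  hp : ∀ h i j : ℕ, h ≤ D → i ≤ D → j ≤ D → ∀ y z : X, G.dist y z = h →
    Nat.card {w : X // G.dist y w = i ∧ G.dist w z = j} = p h i j
  E : ℕ → Matrix X X ℂ
  θ : ℕ → ℝ
  q : ℕ → ℕ → ℕ → ℝ
  hE0 : E 0 = ((Fintype.card X : ℂ))⁻¹ • Matrix.of (fun _ _ => (1 : ℂ))
  hEsum : ∑ i ∈ Finset.range (D + 1), E i = 1
  hEmul : ∀ i ≤ D, ∀ j ≤ D, E i * E j = if i = j then E i else 0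
  hEsym : ∀ i ≤ D, (E i)ᵀ = E i
  hEreal : ∀ i ≤ D, ∀ y z : X, ((E i) y z).im = 0
  hEinM : ∀ i ≤ D, E i ∈ Submodule.span ℂ
    {B : Matrix X X ℂ | ∃ k ≤ D, B = Matrix.of (fun y z => if G.dist y z = k then (1 : ℂ) else 0)}
  hAE : ∀ i ≤ D,
    Matrix.of (fun y z => if G.dist y z = 1 then (1 : ℂ) else 0) * E i = (θ i : ℂ) • E i
  θ_inj : ∀ i ≤ D, ∀ j ≤ D, θ i = θ j → i = j
  hKrein : ∀ i ≤ D, ∀ j ≤ D, Matrix.hadamard (E i) (E j) =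
    ((Fintype.card X : ℂ))⁻¹ • ∑ h ∈ Finset.range (D + 1), (q h i j : ℂ) • E h
  hq_zero : ∀ h ≤ D, ∀ i ≤ D, ∀ j ≤ D, (i + j < h ∨ h + j < i ∨ h + i < j) → q h i j = 0
  hq_ne : ∀ h ≤ D, ∀ i ≤ D, ∀ j ≤ D, (h = i + j ∨ i = h + j ∨ j = h + i) → q h i j ≠ 0

namespace QPolyDRG

variable {X : Type*} [Fintype X] [DecidableEq X] (S : QPolyDRG X) (x : X)

/-- The `i`-th distance matrix `A_i`. -/
def Amat (i : ℕ) : Matrix X X ℂ :=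
  Matrix.of (fun y z => if S.G.dist y z = i then (1 : ℂ) else 0)

/-- The adjacency matrix `A = A_1`. -/
def adj : Matrix X X ℂ := S.Amat 1

/-- The `i`-th dual idempotent `E*_i = E*_i(x)` with respect to the base vertex `x`. -/
def Estar (i : ℕ) : Matrix X X ℂ :=
  Matrix.diagonal (fun y => if S.G.dist x y = i then (1 : ℂ) else 0)

/-- The dual adjacency matrix `A* = A*(x)`, with `(A*)_{yy} = |X| (E_1)_{xy}`. -/
def Astar : Matrix X X ℂ :=
  Matrix.diagonal (fun y => (Fintype.card X : ℂ) * S.E 1 x y)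

/-- The subspace `E_i V` of the standard module, with the convention that it is `0`
for `i ∉ {0, …, D}`. -/
def EV (i : ℤ) : Submodule ℂ (EuclideanSpace ℂ X) :=
  if 0 ≤ i ∧ i ≤ S.D then LinearMap.range (Matrix.toEuclideanLin (S.E i.toNat)) else ⊥

/-- The `i`-th subconstituent `E*_i V` with respect to `x`, with the convention that it is `0`
for `i ∉ {0, …, D}`. -/
def EstarV (i : ℤ) : Submodule ℂ (EuclideanSpace ℂ X) :=
  if 0 ≤ i ∧ i ≤ S.D then LinearMap.range (Matrix.toEuclideanLin (S.Estar x i.toNat)) else ⊥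

/-- The subconstituent (Terwilliger) algebra `T = T(x)`, generated by `A` and `A*`. -/
def Talg : Subalgebra ℂ (Matrix X X ℂ) := Algebra.adjoin ℂ {S.adj, S.Astar x}

/-- A `T`-module: a subspace `W ⊆ V` with `B W ⊆ W` for all `B ∈ T`. -/
def IsTModule (W : Submodule ℂ (EuclideanSpace ℂ X)) : Prop :=
  ∀ B ∈ S.Talg x, ∀ w ∈ W, Matrix.toEuclideanLin B w ∈ W

/-- An irreducible `T`-module. -/
def IsIrredTModule (W : Submodule ℂ (EuclideanSpace ℂ X)) : Prop :=
  S.IsTModule x W ∧ W ≠ ⊥ ∧ ∀ W' ≤ W, S.IsTModule x W' → W' = ⊥ ∨ W' = W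

/-- The subspace `E_i W`, with the convention that it is `0` for `i ∉ {0, …, D}`. -/
def EW (W : Submodule ℂ (EuclideanSpace ℂ X)) (i : ℤ) : Submodule ℂ (EuclideanSpace ℂ X) :=
  if 0 ≤ i ∧ i ≤ S.D then Submodule.map (Matrix.toEuclideanLin (S.E i.toNat)) W else ⊥

/-- The subspace `E*_i W`, with the convention that it is `0` for `i ∉ {0, …, D}`. -/
def EstarW (W : Submodule ℂ (EuclideanSpace ℂ X)) (i : ℤ) : Submodule ℂ (EuclideanSpace ℂ X) :=
  if 0 ≤ i ∧ i ≤ S.D then Submodule.map (Matrix.toEuclideanLin (S.Estar x i.toNat)) W else ⊥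


/-- The endpoint `ρ = min { i : E*_i W ≠ 0 }` of a `T`-module `W`. -/
def endpt (W : Submodule ℂ (EuclideanSpace ℂ X)) : ℕ :=
  sInf {i : ℕ | i ≤ S.D ∧ S.EstarW x W i ≠ ⊥}

/-- The dual endpoint `τ = min { i : E_i W ≠ 0 }` of a `T`-module `W`. -/
def dualEndpt (W : Submodule ℂ (EuclideanSpace ℂ X)) : ℕ :=
  sInf {i : ℕ | i ≤ S.D ∧ S.EW W i ≠ ⊥}

/-- The diameter `d = |{ i : E*_i W ≠ 0 }| - 1` of a `T`-module `W`. -/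
def diam (W : Submodule ℂ (EuclideanSpace ℂ X)) : ℕ :=
  Set.ncard {i : ℕ | i ≤ S.D ∧ S.EstarW x W i ≠ ⊥} - 1

/-- The dual diameter `|{ i : E_i W ≠ 0 }| - 1` of a `T`-module `W`. -/
def dualDiam (W : Submodule ℂ (EuclideanSpace ℂ X)) : ℕ :=
  Set.ncard {i : ℕ | i ≤ S.D ∧ S.EW W i ≠ ⊥} - 1

/-- The split subspace `W^{μν}_h` of an irreducible `T`-module `W` with endpoint `ρ`,
dual endpoint `τ` and diameter `d`.  Here `μ = false` stands for `↓` and `μ = true`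
for `↑`, and similarly for `ν`; e.g.
`W^{↓↓}_h = (E*_ρ W + ⋯ + E*_{ρ+h} W) ∩ (E_τ W + ⋯ + E_{τ+d-h} W)`. -/
def Wsplit (W : Submodule ℂ (EuclideanSpace ℂ X)) (ρ τ d : ℕ) (μ ν : Bool) (h : ℕ) :
    Submodule ℂ (EuclideanSpace ℂ X) :=
  (if μ then ⨆ k ∈ Finset.Icc (ρ + d - h) (ρ + d), S.EstarW x W k
    else ⨆ k ∈ Finset.Icc ρ (ρ + h), S.EstarW x W k) ⊓
  (if ν then ⨆ k ∈ Finset.Icc (τ + h) (τ + d), S.EW W k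
    else ⨆ k ∈ Finset.Icc τ (τ + d - h), S.EW W k)

/-- The subspace `V^{μν}_{i,j}` (interpreted as `0` if `i = -1` or `j = -1`).
Here `μ = false` stands for `↓` and `μ = true` for `↑`, and similarly for `ν`; e.g.
`V^{↓↓}_{i,j} = (E*_0 V + ⋯ + E*_i V) ∩ (E_0 V + ⋯ + E_j V)` and
`V^{↑↑}_{i,j} = (E*_D V + ⋯ + E*_{D-i} V) ∩ (E_D V + ⋯ + E_{D-j} V)`. -/
def Vsplit (μ ν : Bool) (i j : ℤ) : Submodule ℂ (EuclideanSpace ℂ X) :=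
  if 0 ≤ i ∧ 0 ≤ j then
    (if μ then ⨆ k ∈ Finset.Icc (S.D - i.toNat) S.D, S.EstarV x k
      else ⨆ k ∈ Finset.range (i.toNat + 1), S.EstarV x k) ⊓
    (if ν then ⨆ k ∈ Finset.Icc (S.D - j.toNat) S.D, S.EV k
      else ⨆ k ∈ Finset.range (j.toNat + 1), S.EV k)
  else ⊥

/-- The subspace `Ṽ^{μν}_{i,j}`: the orthogonal complement of
`V^{μν}_{i-1,j} + V^{μν}_{i,j-1}` in `V^{μν}_{i,j}` with respect to the standard
Hermitian form. -/
def tildeV (μ ν : Bool) (i j : ℕ) : Submodule ℂ (EuclideanSpace ℂ X) :=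
  S.Vsplit x μ ν i j ⊓ (S.Vsplit x μ ν ((i : ℤ) - 1) j ⊔ S.Vsplit x μ ν i ((j : ℤ) - 1))ᗮ

end QPolyDRG

namespace QPolyDRG

section abstractPart

variable {V : Type*} [NormedAddCommGroup V] [InnerProductSpace ℂ V]

/-- One half of a tridiagonal system: a family of orthogonal projections `P k`, on whose images
`a` acts as a scalar, and for which `b` is block tridiagonal. -/
structure Half (P : ℤ → V →ₗ[ℂ] V) (a b : V →ₗ[ℂ] V) (θ : ℤ → ℂ) : Prop where
  idem : ∀ k l v, P k (P l v) = if k = l then P l v else 0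
  sum : ∃ s : Finset ℤ, ∀ v, ∑ k ∈ s, P k v = v
  scal : ∀ k v, P k (a v) = θ k • P k v
  tri : ∀ h v, (∀ k, h - 1 ≤ k → k ≤ h + 1 → P k v = 0) → P h (b v) = 0
  symm : ∀ k v w, inner ℂ (P k v) w = inner ℂ v (P k w)

variable {P Q : ℤ → V →ₗ[ℂ] V} {a b : V →ₗ[ℂ] V} {θ φ : ℤ → ℂ}

theorem Half.reindex (H : Half P a b θ) (e : ℤ ≃ ℤ)
    (he : ∀ h k, e h - 1 ≤ k → k ≤ e h + 1 → h - 1 ≤ e.symm k ∧ e.symm k ≤ h + 1) :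
    Half (fun k => P (e k)) a b (fun k => θ (e k)) where
  idem k l v := by
    rw [H.idem]; simp
  sum := by
    obtain ⟨s, hs⟩ := H.sum
    refine ⟨s.map e.symm.toEmbedding, fun v => ?_⟩
    rw [Finset.sum_map]
    simpa using hs v
  scal k v := H.scal _ _
  tri h v hv := by
    apply H.tri
    intro k h1 h2
    have := he h k h1 h2
    simpa using hv _ this.1 this.2
  symm k v w := H.symm _ _ _

theorem Half.shift (H : Half P a b θ) (c : ℤ) :
    Half (fun k => P (c + k)) a b (fun k => θ (c + k)) :=
  H.reindex (Equiv.addLeft c) (by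
    intro h k h1 h2
    simp only [Equiv.coe_addLeft, Equiv.addLeft_symm] at *
    omega)

theorem Half.flip (H : Half P a b θ) (c : ℤ) :
    Half (fun k => P (c - k)) a b (fun k => θ (c - k)) :=
  H.reindex (Equiv.subLeft c) (by
    intro h k h1 h2
    simp only [Equiv.subLeft_apply, Equiv.subLeft_symm_apply] at *
    omega)

theorem Half.eq_zero (H : Half P a b θ) {v : V} (h : ∀ k, P k v = 0) : v = 0 := by
  obtain ⟨s, hs⟩ := H.sum
  rw [← hs v]
  simp [h]

/-- Irreducibility under two maps. -/
structure Irr (W : Submodule ℂ V) (a b : V →ₗ[ℂ] V) : Prop where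
  ha : ∀ v ∈ W, a v ∈ W
  hb : ∀ v ∈ W, b v ∈ W
  irr : ∀ W' ≤ W, (∀ v ∈ W', a v ∈ W') → (∀ v ∈ W', b v ∈ W') → W' = ⊥ ∨ W' = W

theorem Irr.swap {W : Submodule ℂ V} (h : Irr W a b) : Irr W b a :=
  ⟨h.hb, h.ha, fun W' h1 h2 h3 => h.irr W' h1 h3 h2⟩

theorem Half.interval (H : Half P a b θ) {W : Submodule ℂ V} (hW : Irr W a b)
    (hP : ∀ k, ∀ v ∈ W, P k v ∈ W) {k0 m k1 : ℤ} (h0 : k0 < m) (h1 : m < k1)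
    (hk0 : ∃ v ∈ W, P k0 v ≠ 0) (hk1 : ∃ v ∈ W, P k1 v ≠ 0) : ∃ v ∈ W, P m v ≠ 0 := by
  by_contra hc
  push Not at hc
  let W' : Submodule ℂ V :=
    { carrier := {v | v ∈ W ∧ ∀ k, m ≤ k → P k v = 0}
      add_mem' := by
        rintro u v ⟨hu, hu'⟩ ⟨hv, hv'⟩
        refine ⟨W.add_mem hu hv, fun k hk => ?_⟩
        rw [map_add, hu' k hk, hv' k hk, add_zero]
      zero_mem' := ⟨W.zero_mem, by simp⟩
      smul_mem' := by
        rintro c v ⟨hv, hv'⟩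
        refine ⟨W.smul_mem c hv, fun k hk => ?_⟩
        rw [map_smul, hv' k hk, smul_zero] }
  have hmem : ∀ v, v ∈ W' ↔ v ∈ W ∧ ∀ k, m ≤ k → P k v = 0 := fun v => Iff.rfl
  have hA : ∀ v ∈ W', a v ∈ W' := by
    intro v hv
    rw [hmem] at hv ⊢
    refine ⟨hW.ha _ hv.1, fun k hk => ?_⟩
    rw [H.scal, hv.2 k hk, smul_zero]
  have hB : ∀ v ∈ W', b v ∈ W' := by
    intro v hv
    rw [hmem] at hv ⊢
    refine ⟨hW.hb _ hv.1, fun k hk => ?_⟩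
    rcases hk.eq_or_lt with rfl | hk
    · exact hc _ (hW.hb _ hv.1)
    · apply H.tri
      intro l hl _
      exact hv.2 l (by omega)
  rcases hW.irr W' (fun v hv => hv.1) hA hB with h | h
  · obtain ⟨v, hv, hv0⟩ := hk0
    have : P k0 v ∈ W' := by
      rw [hmem]
      refine ⟨hP _ _ hv, fun k hk => ?_⟩
      rw [H.idem, if_neg (by omega)]
    rw [h] at this
    exact hv0 (by simpa using this)
  · obtain ⟨v, hv, hv0⟩ := hk1
    rw [← h, hmem] at hv
    exact hv0 (hv.2 _ h1.le)

/-- `VF Q P i j`: vectors with `Q`-support in `(-∞, i]` and `P`-support in `[j, ∞)`. -/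
def VF (Q P : ℤ → V →ₗ[ℂ] V) (i j : ℤ) : Submodule ℂ V where
  carrier := {v | (∀ k, i < k → Q k v = 0) ∧ ∀ k, k < j → P k v = 0}
  add_mem' := by
    rintro u v ⟨hu, hu'⟩ ⟨hv, hv'⟩
    refine ⟨fun k hk => ?_, fun k hk => ?_⟩
    · rw [map_add, hu k hk, hv k hk, add_zero]
    · rw [map_add, hu' k hk, hv' k hk, add_zero]
  zero_mem' := ⟨by simp, by simp⟩
  smul_mem' := by
    rintro c v ⟨hv, hv'⟩
    refine ⟨fun k hk => ?_, fun k hk => ?_⟩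
    · rw [map_smul, hv k hk, smul_zero]
    · rw [map_smul, hv' k hk, smul_zero]

theorem mem_VF {i j : ℤ} {v : V} :
    v ∈ VF Q P i j ↔ (∀ k, i < k → Q k v = 0) ∧ ∀ k, k < j → P k v = 0 := Iff.rfl

theorem a_step (H : Half P a b θ) (K : Half Q b a φ) {W : Submodule ℂ V} (hW : Irr W a b)
    {i j : ℤ} {v : V} (hv : v ∈ W ⊓ VF Q P i j) :
    a v - θ j • v ∈ W ⊓ VF Q P (i + 1) (j + 1) := by
  obtain ⟨h0, h1, h2⟩ := hv
  refine ⟨W.sub_mem (hW.ha _ h0) (W.smul_mem _ h0), fun k hk => ?_, fun k hk => ?_⟩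
  · rw [map_sub, map_smul, h1 k (by omega), smul_zero, sub_zero]
    exact K.tri _ _ fun l hl _ => h1 l (by omega)
  · rw [map_sub, map_smul, H.scal]
    rcases eq_or_ne k j with rfl | hne
    · simp
    · rw [h2 k (by omega)]; simp

theorem b_step (H : Half P a b θ) (K : Half Q b a φ) {W : Submodule ℂ V} (hW : Irr W a b)
    {i j : ℤ} {v : V} (hv : v ∈ W ⊓ VF Q P i j) :
    b v - φ i • v ∈ W ⊓ VF Q P (i - 1) (j - 1) := by
  obtain ⟨h0, h1, h2⟩ := hv
  refine ⟨W.sub_mem (hW.hb _ h0) (W.smul_mem _ h0), fun k hk => ?_, fun k hk => ?_⟩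
  · rw [map_sub, map_smul, K.scal]
    rcases eq_or_ne k i with rfl | hne
    · simp
    · rw [h1 k (by omega)]; simp
  · rw [map_sub, map_smul, h2 k (by omega), smul_zero, sub_zero]
    exact H.tri _ _ fun l _ hl => h2 l (by omega)

theorem sum_inv (H : Half P a b θ) (K : Half Q b a φ) {W : Submodule ℂ V} (hW : Irr W a b)
    (r : ℤ) (I : Set ℤ)
    (h1 : ∀ i ∈ I, i + 1 ∈ I ∨ W ⊓ VF Q P (i + 1) (i + 1 + r) = ⊥)
    (h2 : ∀ i ∈ I, i - 1 ∈ I) :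
    (⨆ i ∈ I, W ⊓ VF Q P i (i + r)) = ⊥ ∨ (⨆ i ∈ I, W ⊓ VF Q P i (i + r)) = W := by
  have key : ∀ i ∈ I, W ⊓ VF Q P i (i + r) ≤ ⨆ i ∈ I, W ⊓ VF Q P i (i + r) :=
    fun i hi => le_iSup₂_of_le i hi le_rfl
  apply hW.irr
  · exact iSup₂_le fun i _ => inf_le_left
  · suffices h : (⨆ i ∈ I, W ⊓ VF Q P i (i + r)) ≤
        (⨆ i ∈ I, W ⊓ VF Q P i (i + r)).comap a from fun v hv => h hv
    refine iSup₂_le fun i hi v hv => ?_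
    rw [Submodule.mem_comap]
    have hs := a_step H K hW hv
    have e : a v = (a v - θ (i + r) • v) + θ (i + r) • v := by abel
    rw [e]
    refine Submodule.add_mem _ ?_ (Submodule.smul_mem _ _ (key i hi hv))
    rw [show i + r + 1 = i + 1 + r by ring] at hs
    rcases h1 i hi with h | h
    · exact key _ h hs
    · rw [h] at hs
      rw [(Submodule.mem_bot ℂ).1 hs]
      exact Submodule.zero_mem _
  · suffices h : (⨆ i ∈ I, W ⊓ VF Q P i (i + r)) ≤
        (⨆ i ∈ I, W ⊓ VF Q P i (i + r)).comap b from fun v hv => h hv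
    refine iSup₂_le fun i hi v hv => ?_
    rw [Submodule.mem_comap]
    have hs := b_step H K hW hv
    have e : b v = (b v - φ i • v) + φ i • v := by abel
    rw [e]
    refine Submodule.add_mem _ ?_ (Submodule.smul_mem _ _ (key i hi hv))
    rw [show i + r - 1 = i - 1 + r by ring] at hs
    exact key _ (h2 i hi) hs

/-- Support of `P` on `W` is contained in `[0,d]` with nonzero ends. -/
structure Supp (P : ℤ → V →ₗ[ℂ] V) (W : Submodule ℂ V) (d : ℤ) : Prop where
  inv : ∀ k, ∀ v ∈ W, P k v ∈ W
  neg : ∀ k, k < 0 → ∀ v ∈ W, P k v = 0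
  big : ∀ k, d < k → ∀ v ∈ W, P k v = 0
  zero : ∃ v ∈ W, P 0 v ≠ 0
  top : ∃ v ∈ W, P d v ≠ 0

theorem vanish (H : Half P a b θ) (K : Half Q b a φ) {W : Submodule ℂ V} (hW : Irr W a b)
    {d δ : ℤ} (sP : Supp P W d) (sQ : Supp Q W δ) {i j : ℤ} (hij : 0 < j - i ∨ d - δ < j - i) :
    W ⊓ VF Q P i j = ⊥ := by
  have h := sum_inv H K hW (j - i) Set.univ (by simp) (by simp)
  have hle : W ⊓ VF Q P i j ≤ ⨆ l ∈ Set.univ, W ⊓ VF Q P l (l + (j - i)) :=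
    le_iSup₂_of_le i trivial (by rw [add_sub_cancel])
  rcases h with h | h
  · rw [h] at hle
    exact le_bot_iff.1 hle
  exfalso
  rcases hij with hij | hij
  · -- everything is killed by `P 0`
    obtain ⟨v, hv, hv0⟩ := sP.zero
    have : (⨆ l ∈ Set.univ, W ⊓ VF Q P l (l + (j - i))) ≤ LinearMap.ker (P 0) := by
      refine iSup₂_le fun l _ u hu => ?_
      obtain ⟨u0, u1, u2⟩ := hu
      rw [LinearMap.mem_ker]
      rcases lt_or_ge l 0 with hl | hl
      · have : u = 0 := by
          apply K.eq_zero
          intro k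
          rcases lt_or_ge k 0 with hk | hk
          · exact sQ.neg k hk u u0
          · exact u1 k (by omega)
        rw [this, map_zero]
      · exact u2 0 (by omega)
    rw [h] at this
    exact hv0 (this hv)
  · obtain ⟨v, hv, hv0⟩ := sQ.top
    have : (⨆ l ∈ Set.univ, W ⊓ VF Q P l (l + (j - i))) ≤ LinearMap.ker (Q δ) := by
      refine iSup₂_le fun l _ u hu => ?_
      obtain ⟨u0, u1, u2⟩ := hu
      rw [LinearMap.mem_ker]
      rcases lt_or_ge l δ with hl | hl
      · exact u1 _ hl
      · have : u = 0 := by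
          apply H.eq_zero
          intro k
          rcases lt_or_ge d k with hk | hk
          · exact sP.big k hk u u0
          · exact u2 k (by omega)
        rw [this, map_zero]
    rw [h] at this
    exact hv0 (this hv)

theorem zero_zero_ne (K : Half Q b a φ) {W : Submodule ℂ V}
    {d δ : ℤ} (sP : Supp P W d) (sQ : Supp Q W δ) : W ⊓ VF Q P 0 0 ≠ ⊥ := by
  obtain ⟨v, hv, hv0⟩ := sQ.zero
  rw [Submodule.ne_bot_iff]
  refine ⟨Q 0 v, ⟨sQ.inv _ _ hv, fun k hk => ?_, fun k hk => ?_⟩, hv0⟩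
  · rw [K.idem, if_neg (by omega)]
  · exact sP.neg k hk _ (sQ.inv _ _ hv)

theorem diam_eq (H : Half P a b θ) (K : Half Q b a φ) {W : Submodule ℂ V} (hW : Irr W a b)
    {d δ : ℤ} (sP : Supp P W d) (sQ : Supp Q W δ) : d = δ := by
  apply le_antisymm
  · by_contra hc
    push Not at hc
    have h0 := vanish H K hW sP sQ (i := δ) (j := δ + 1) (Or.inl (by omega))
    obtain ⟨v, hv, hv0⟩ := sP.top
    apply hv0
    have : P d v ∈ W ⊓ VF Q P δ (δ + 1) := by
      refine ⟨sP.inv _ _ hv, fun k hk => sQ.big k hk _ (sP.inv _ _ hv), fun k hk => ?_⟩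
      rw [H.idem, if_neg (by omega)]
    rw [h0] at this
    simpa using this
  · by_contra hc
    exact zero_zero_ne K sP sQ (vanish H K hW sP sQ (Or.inr (by omega)))

theorem nonzero (H : Half P a b θ) (K : Half Q b a φ) {W : Submodule ℂ V} (hW : Irr W a b)
    {d : ℤ} (sP : Supp P W d) (sQ : Supp Q W d) {h : ℤ} (h0 : 0 ≤ h) (hd : h ≤ d) :
    W ⊓ VF Q P h h ≠ ⊥ := by
  intro hbot
  have hz := zero_zero_ne K sP sQ
  rcases h0.eq_or_lt with rfl | h0
  · exact hz hbot
  have key := sum_inv H K hW 0 (Set.Iio h) (by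
      intro i hi
      rw [Set.mem_Iio] at hi ⊢
      rcases eq_or_ne (i + 1) h with e | e
      · right
        rw [add_zero, e, hbot]
      · left
        omega)
      (by
        intro i hi
        rw [Set.mem_Iio] at hi ⊢
        omega)
  rcases key with key | key
  · apply hz
    rw [← le_bot_iff, ← key]
    exact le_iSup₂_of_le 0 h0 (by rw [add_zero])
  · obtain ⟨v, hv, hv0⟩ := sQ.top
    have : (⨆ l ∈ Set.Iio h, W ⊓ VF Q P l (l + 0)) ≤ LinearMap.ker (Q d) := by
      refine iSup₂_le fun l hl u hu => ?_
      obtain ⟨u0, u1, u2⟩ := hu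
      rw [Set.mem_Iio] at hl
      exact u1 _ (by omega)
    rw [key] at this
    exact hv0 (this hv)

theorem proj_zero (H : Half P a b θ) {W : Submodule ℂ V}
    (inv : ∀ k, ∀ v ∈ W, P k v ∈ W) {k : ℤ} {p q : V} (hp : p ∈ W) (hq : q ∈ Wᗮ)
    (h : P k (p + q) = 0) : P k p = 0 := by
  have h1 : P k q ∈ Wᗮ := by
    rw [Submodule.mem_orthogonal'] at hq ⊢
    intro u hu
    rw [H.symm]
    exact hq _ (inv _ _ hu)
  rw [map_add, add_eq_zero_iff_eq_neg] at h
  have h2 : P k p ∈ Wᗮ := by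
    rw [h]; exact Submodule.neg_mem _ h1
  have := Submodule.inner_right_of_mem_orthogonal (inv k _ hp) h2
  exact inner_self_eq_zero.1 this

theorem core [FiniteDimensional ℂ V] (H : Half P a b θ) (K : Half Q b a φ) {W : Submodule ℂ V}
    (hW : Irr W a b)
    {d : ℤ} (sP : Supp P W d) (sQ : Supp Q W d) {h : ℤ} (h0 : 0 ≤ h) (hd : h ≤ d) (i j : ℤ) :
    W ⊓ VF Q P h h ≤ VF Q P i j ⊓ (VF Q P (i - 1) j ⊔ VF Q P i (j + 1))ᗮ ↔ i = h ∧ j = h := by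
  constructor
  · intro hle
    obtain ⟨w, hw, hw0⟩ := (Submodule.ne_bot_iff _).1 (nonzero H K hW sP sQ h0 hd)
    obtain ⟨w1, w2⟩ := hle hw
    have hself : w ∉ VF Q P (i - 1) j ⊔ VF Q P i (j + 1) := fun hc =>
      hw0 (inner_self_eq_zero.1 (Submodule.inner_right_of_mem_orthogonal hc w2))
    have hi : i ≤ h := by
      by_contra hc
      apply hself
      refine Submodule.mem_sup_left ⟨fun k hk => hw.2.1 k (by omega), w1.2⟩
    have hj : h ≤ j := by
      by_contra hc
      apply hself
      refine Submodule.mem_sup_right ⟨w1.1, fun k hk => hw.2.2 k (by omega)⟩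
    by_contra hc
    have hv := vanish H K hW sP sQ (i := i) (j := j) (Or.inl (by omega))
    have : w ∈ W ⊓ VF Q P i j := ⟨hw.1, w1⟩
    rw [hv] at this
    exact hw0 (by simpa using this)
  · rintro ⟨rfl, rfl⟩
    refine le_inf inf_le_right ?_
    suffices hs : ∀ i' j', i' < j' → VF Q P i' j' ≤ Wᗮ by
      intro w hw
      rw [Submodule.mem_orthogonal]
      intro u hu
      have hu' : u ∈ Wᗮ := (sup_le (hs _ _ (by omega)) (hs _ _ (by omega))) hu
      exact Submodule.inner_left_of_mem_orthogonal hw.1 hu'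
    intro i' j' hij v hv
    obtain ⟨p, hp, q, hq, rfl⟩ := W.exists_add_mem_mem_orthogonal v
    have : p ∈ W ⊓ VF Q P i' j' :=
      ⟨hp, fun k hk => proj_zero K sQ.inv hp hq (hv.1 k hk),
        fun k hk => proj_zero H sP.inv hp hq (hv.2 k hk)⟩
    rw [vanish H K hW sP sQ (Or.inl (by omega))] at this
    rw [(Submodule.mem_bot ℂ).1 this, zero_add]
    exact hq

theorem sup_mem (H : Half P a b θ) {W : Submodule ℂ V} (inv : ∀ k, ∀ v ∈ W, P k v ∈ W)
    (s : Finset ℕ) (e : ℤ → ℤ) (R : ℤ → Prop)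
    (h1 : ∀ l : ℤ, (∃ k, R k ∧ e k = l) ∨ (∃ n ∈ s, (n : ℤ) = l) ∨ ∀ v ∈ W, P l v = 0)
    (h2 : ∀ k, R k → ∀ n ∈ s, (n : ℤ) ≠ e k) (v : V) :
    v ∈ (⨆ k ∈ s, Submodule.map (P (k : ℤ)) W) ↔ v ∈ W ∧ ∀ k, R k → P (e k) v = 0 := by
  constructor
  · intro hv
    constructor
    · have : (⨆ k ∈ s, Submodule.map (P (k : ℤ)) W) ≤ W := by
        refine iSup₂_le fun k _ => ?_
        rintro _ ⟨u, hu, rfl⟩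
        exact inv _ _ hu
      exact this hv
    · intro k hk
      have : (⨆ k ∈ s, Submodule.map (P (k : ℤ)) W) ≤ LinearMap.ker (P (e k)) := by
        refine iSup₂_le fun n hn => ?_
        rintro _ ⟨u, hu, rfl⟩
        rw [LinearMap.mem_ker, H.idem, if_neg (h2 k hk n hn).symm]
      exact this hv
  · rintro ⟨hv, h⟩
    obtain ⟨t, ht⟩ := H.sum
    rw [← ht v]
    refine Submodule.sum_mem _ fun l _ => ?_
    rcases h1 l with ⟨k, hk, rfl⟩ | ⟨n, hn, rfl⟩ | h0
    · rw [h k hk]; exact Submodule.zero_mem _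
    · exact (le_iSup₂_of_le (f := fun (k : ℕ) (_ : k ∈ s) => Submodule.map (P (k : ℤ)) W)
        n hn le_rfl) (Submodule.mem_map_of_mem hv)
    · rw [h0 v hv]; exact Submodule.zero_mem _

theorem Supp.flip {W : Submodule ℂ V} {lo d : ℤ} (s : Supp (fun k => P (lo + k)) W d) :
    Supp (fun k => P (lo + d - k)) W d where
  inv k v hv := by
    have := s.inv (d - k) v hv
    simpa [add_sub_assoc] using this
  neg k hk v hv := by
    have := s.big (d - k) (by omega) v hv
    simpa [add_sub_assoc] using this
  big k hk v hv := by
    have := s.neg (d - k) (by omega) v hv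
    simpa [add_sub_assoc] using this
  zero := by simpa using s.top
  top := by simpa using s.zero

theorem map_ne_bot {W : Submodule ℂ V} (f : V →ₗ[ℂ] V) :
    Submodule.map f W ≠ ⊥ ↔ ∃ v ∈ W, f v ≠ 0 := by
  rw [Submodule.ne_bot_iff]
  constructor
  · rintro ⟨_, ⟨v, hv, rfl⟩, h⟩
    exact ⟨v, hv, h⟩
  · rintro ⟨v, hv, h⟩
    exact ⟨f v, ⟨v, hv, rfl⟩, h⟩

theorem supp_of (H : Half P a b θ) {W : Submodule ℂ V} (hW : Irr W a b)
    (inv : ∀ k, ∀ v ∈ W, P k v ∈ W) {D : ℕ} (hr : ∀ k : ℤ, ¬ (0 ≤ k ∧ k ≤ D) → P k = 0)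
    {lo : ℕ} (hlo : IsLeast {i : ℕ | i ≤ D ∧ ∃ v ∈ W, P (i : ℤ) v ≠ 0} lo) :
    ∃ d : ℕ, lo + d ≤ D ∧ Supp (fun k => P ((lo : ℤ) + k)) W d ∧
      {i : ℕ | i ≤ D ∧ ∃ v ∈ W, P (i : ℤ) v ≠ 0}.ncard = d + 1 := by
  set S : Set ℕ := {i : ℕ | i ≤ D ∧ ∃ v ∈ W, P (i : ℤ) v ≠ 0} with hS
  have hfin : S.Finite := (Set.finite_Iic D).subset fun i hi => hi.1
  obtain ⟨hi, hmax⟩ : ∃ m, IsGreatest S m := by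
    obtain ⟨m, hm, hm'⟩ := hfin.exists_maximalFor id S ⟨lo, hlo.1⟩
    refine ⟨m, hm, fun k hk => ?_⟩
    rcases le_total k m with h | h
    · exact h
    · exact hm' hk h
  have hle : lo ≤ hi := hlo.2 hmax.1
  have hSeq : S = Set.Icc lo hi := by
    ext m
    constructor
    · intro hm
      exact ⟨hlo.2 hm, hmax.2 hm⟩
    · rintro ⟨h1, h2⟩
      rcases h1.eq_or_lt with rfl | h1
      · exact hlo.1
      rcases h2.eq_or_lt with rfl | h2
      · exact hmax.1
      refine ⟨h2.le.trans hmax.1.1, ?_⟩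
      exact H.interval hW inv (k0 := lo) (k1 := hi) (by omega) (by omega) hlo.1.2 hmax.1.2
  have hout : ∀ k : ℤ, ¬ ((lo : ℤ) ≤ k ∧ k ≤ hi) → ∀ v ∈ W, P k v = 0 := by
    intro k hk v hv
    by_contra hc
    by_cases hkr : 0 ≤ k ∧ k ≤ D
    · obtain ⟨n, rfl⟩ := Int.eq_ofNat_of_zero_le hkr.1
      have : n ∈ S := ⟨by omega, v, hv, hc⟩
      rw [hSeq, Set.mem_Icc] at this
      omega
    · rw [hr k hkr] at hc
      exact hc rfl
  have hcast : (lo : ℤ) + ((hi - lo : ℕ) : ℤ) = hi := by omega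
  refine ⟨hi - lo, ?_, ⟨?_, ?_, ?_, ?_, ?_⟩, ?_⟩
  · have := hmax.1.1
    omega
  · intro k v hv; exact inv _ _ hv
  · intro k hk v hv; exact hout _ (by omega) v hv
  · intro k hk v hv; exact hout _ (by omega) v hv
  · simpa using hlo.1.2
  · simp only [hcast]; exact hmax.1.2
  · rw [hSeq, Set.ncard_eq_toFinset_card', Set.toFinset_Icc, Nat.card_Icc]
    omega

end abstractPart

end QPolyDRG

namespace QPolyDRG

section concretePart

variable {X : Type*} [Fintype X] [DecidableEq X]

theorem lin_mul (A B : Matrix X X ℂ) (v : EuclideanSpace ℂ X) :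
    Matrix.toEuclideanLin (A * B) v = Matrix.toEuclideanLin A (Matrix.toEuclideanLin B v) := by
  simp [Matrix.toLpLin_apply, Matrix.mulVec_mulVec]

theorem lin_one (v : EuclideanSpace ℂ X) :
    Matrix.toEuclideanLin (1 : Matrix X X ℂ) v = v := by
  simp

/-- Integer-indexed family of maps attached to a family of matrices. -/
def PZ (D : ℕ) (M : ℕ → Matrix X X ℂ) (k : ℤ) : EuclideanSpace ℂ X →ₗ[ℂ] EuclideanSpace ℂ X :=
  if 0 ≤ k ∧ k ≤ D then Matrix.toEuclideanLin (M k.toNat) else 0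

theorem PZ_nat {D : ℕ} (M : ℕ → Matrix X X ℂ) {n : ℕ} (h : n ≤ D) :
    PZ D M (n : ℤ) = Matrix.toEuclideanLin (M n) := by
  rw [PZ, if_pos (by omega)]; simp

theorem PZ_out {D : ℕ} (M : ℕ → Matrix X X ℂ) (k : ℤ) (h : ¬ (0 ≤ k ∧ k ≤ D)) :
    PZ D M k = 0 := by
  rw [PZ, if_neg h]

theorem PZ_cases (D : ℕ) (k : ℤ) : (∃ n : ℕ, n ≤ D ∧ k = n) ∨ ¬ (0 ≤ k ∧ k ≤ D) := by
  by_cases h : 0 ≤ k ∧ k ≤ D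
  · left
    obtain ⟨n, rfl⟩ := Int.eq_ofNat_of_zero_le h.1
    exact ⟨n, by omega, rfl⟩
  · right; exact h

theorem half_of {D : ℕ} {M : ℕ → Matrix X X ℂ} {a b : Matrix X X ℂ} {θ : ℕ → ℂ}
    (mul : ∀ i ≤ D, ∀ j ≤ D, M i * M j = if i = j then M i else 0)
    (sum : ∑ i ∈ Finset.range (D + 1), M i = 1)
    (herm : ∀ i ≤ D, (M i).IsHermitian)
    (scal : ∀ i ≤ D, M i * a = θ i • M i)
    (tri : ∀ h ≤ D, ∀ l ≤ D, (h + 1 < l ∨ l + 1 < h) → M h * b * M l = 0) :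
    Half (PZ D M) (Matrix.toEuclideanLin a) (Matrix.toEuclideanLin b) (fun k => θ k.toNat) := by
  have hsum : ∀ v : EuclideanSpace ℂ X,
      ∑ i ∈ Finset.range (D + 1), Matrix.toEuclideanLin (M i) v = v := by
    intro v
    conv_rhs => rw [← lin_one v, ← sum, map_sum, LinearMap.sum_apply]
  refine ⟨?_, ?_, ?_, ?_, ?_⟩
  · intro k l v
    rcases PZ_cases D k with ⟨m, hm, rfl⟩ | hk
    · rcases PZ_cases D l with ⟨n, hn, rfl⟩ | hl
      · rw [PZ_nat M hm, PZ_nat M hn, ← lin_mul, mul m hm n hn]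
        by_cases h : m = n
        · subst h; simp
        · simp [h]
      · rw [PZ_out M l hl]; simp
    · rw [PZ_out M k hk]
      split_ifs with h
      · subst h; rw [PZ_out M k hk]; rfl
      · rfl
  · refine ⟨(Finset.range (D + 1)).map Nat.castEmbedding, fun v => ?_⟩
    rw [Finset.sum_map]
    conv_rhs => rw [← hsum v]
    refine Finset.sum_congr rfl fun i hi => ?_
    rw [Finset.mem_range] at hi
    rw [Nat.castEmbedding_apply, PZ_nat M (by omega)]
  · intro k v
    rcases PZ_cases D k with ⟨m, hm, rfl⟩ | hk
    · rw [PZ_nat M hm, ← lin_mul, scal m hm]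
      simp
    · rw [PZ_out M k hk]; simp
  · intro k v hv
    rcases PZ_cases D k with ⟨m, hm, rfl⟩ | hk
    · rw [PZ_nat M hm]
      conv_lhs => rw [← hsum v]
      rw [map_sum, map_sum]
      refine Finset.sum_eq_zero fun l hl => ?_
      rw [Finset.mem_range] at hl
      by_cases hc : m + 1 < l ∨ l + 1 < m
      · rw [← lin_mul, ← lin_mul, tri m hm l (by omega) hc]
        simp
      · have := hv l (by omega) (by omega)
        rw [PZ_nat M (by omega)] at this
        rw [this, map_zero, map_zero]
    · rw [PZ_out M k hk]; rfl
  · intro k v w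
    rcases PZ_cases D k with ⟨m, hm, rfl⟩ | hk
    · rw [PZ_nat M hm]
      exact (Matrix.isSymmetric_toEuclideanLin_iff.2 (herm m hm)) v w
    · rw [PZ_out M k hk]; simp

variable (S : QPolyDRG X) (x : X)

theorem card_ne (S : QPolyDRG X) : (Fintype.card X : ℂ) ≠ 0 := by
  have : Nonempty X := S.conn.nonempty
  exact Nat.cast_ne_zero.2 Fintype.card_ne_zero

theorem E_const {k : ℕ} (hk : k ≤ S.D) {y z y' z' : X} (h : S.G.dist y z = S.G.dist y' z') :
    S.E k y z = S.E k y' z' := by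
  have := S.hEinM k hk
  generalize S.E k = B at this ⊢
  induction this using Submodule.span_induction with
  | mem B hB =>
    obtain ⟨l, _, rfl⟩ := hB
    simp [h]
  | zero => rfl
  | add A B _ _ hA hB => simp [hA, hB]
  | smul c A _ hA => simp [hA]

theorem E_star {k : ℕ} (hk : k ≤ S.D) (y z : X) : star (S.E k y z) = S.E k y z :=
  Complex.conj_eq_iff_im.2 (S.hEreal k hk y z)

theorem E_symm {k : ℕ} (hk : k ≤ S.D) (y z : X) : S.E k y z = S.E k z y := by
  conv_lhs => rw [← S.hEsym k hk]
  rfl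

theorem E_herm {k : ℕ} (hk : k ≤ S.D) : (S.E k).IsHermitian := by
  ext y z
  rw [Matrix.conjTranspose_apply, E_star S hk, E_symm S hk]

theorem adj_symm : S.adjᵀ = S.adj := by
  ext y z
  simp only [adj, Amat, Matrix.transpose_apply, Matrix.of_apply]
  rw [SimpleGraph.dist_comm]

theorem adj_mul_E {k : ℕ} (hk : k ≤ S.D) : S.adj * S.E k = (S.θ k : ℂ) • S.E k := S.hAE k hk

theorem E_mul_adj {k : ℕ} (hk : k ≤ S.D) : S.E k * S.adj = (S.θ k : ℂ) • S.E k := by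
  have := congrArg Matrix.transpose (adj_mul_E S hk)
  rwa [Matrix.transpose_mul, Matrix.transpose_smul, S.hEsym k hk, adj_symm] at this

theorem aeval_mul_E (p : Polynomial ℂ) {k : ℕ} (hk : k ≤ S.D) :
    Polynomial.aeval S.adj p * S.E k = p.eval (S.θ k : ℂ) • S.E k := by
  induction p using Polynomial.induction_on' with
  | add p q hp hq => rw [map_add, add_mul, hp, hq, Polynomial.eval_add, add_smul]
  | monomial n c =>
    rw [Polynomial.aeval_monomial, Polynomial.eval_monomial]
    induction n generalizing c with
    | zero => simp [Algebra.algebraMap_eq_smul_one]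
    | succ n ih =>
      rw [pow_succ, ← mul_assoc, mul_assoc _ S.adj, adj_mul_E S hk, mul_smul_comm, ih, smul_smul]
      congr 1
      ring

theorem aeval_adj (p : Polynomial ℂ) :
    Polynomial.aeval S.adj p = ∑ k ∈ Finset.range (S.D + 1), p.eval (S.θ k : ℂ) • S.E k := by
  rw [← mul_one (Polynomial.aeval S.adj p), ← S.hEsum, Finset.mul_sum]
  refine Finset.sum_congr rfl fun k hk => ?_
  rw [Finset.mem_range] at hk
  exact aeval_mul_E S p (by omega)

theorem E_mem {k : ℕ} (hk : k ≤ S.D) : S.E k ∈ S.Talg x := by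
  obtain ⟨p, hp⟩ := (Polynomial.exists_eval_eq_iff (fun i : Fin (S.D + 1) => (S.θ i : ℂ))
    (fun i => if (i : ℕ) = k then 1 else 0)).2 (by
      intro i j hij
      have := S.θ_inj i (by omega) j (by omega) (by exact_mod_cast hij)
      simp [this])
  have : S.E k = Polynomial.aeval S.adj p := by
    rw [aeval_adj, Finset.sum_eq_single k]
    · have := hp ⟨k, by omega⟩
      simp only [if_true] at this
      rw [this, one_smul]
    · intro l hl hne
      rw [Finset.mem_range] at hl
      have := hp ⟨l, hl⟩
      simp only [if_neg hne] at this
      rw [this, zero_smul]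
    · intro h; exact absurd (Finset.mem_range.2 (by omega)) h
  rw [this]
  exact Algebra.adjoin_mono (by simp) (Polynomial.aeval_mem_adjoin_singleton ℂ _)

theorem E_all {y z y' z' : X} (h : S.E 1 y z = S.E 1 y' z') (k : ℕ) :
    k ≤ S.D → S.E k y z = S.E k y' z' := by
  have h3 := S.hD3
  induction k using Nat.strong_induction_on with
  | _ k ih =>
    intro hk
    rcases Nat.eq_zero_or_pos k with rfl | hpos
    · rw [S.hE0]; simp
    obtain ⟨m, rfl⟩ : ∃ m, k = m + 1 := ⟨k - 1, by omega⟩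
    have hkr := S.hKrein 1 (by omega) m (by omega)
    have e1 := congrFun (congrFun hkr y) z
    have e2 := congrFun (congrFun hkr y') z'
    simp only [Matrix.hadamard_apply, Matrix.smul_apply, Matrix.sum_apply, smul_eq_mul] at e1 e2
    rw [h, ih m (by omega) (by omega), e2] at e1
    have e3 := mul_left_cancel₀ (inv_ne_zero (card_ne S)) e1
    rw [← sub_eq_zero, ← Finset.sum_sub_distrib, Finset.sum_eq_single (m + 1)] at e3
    · rw [← mul_sub, mul_eq_zero] at e3
      rcases e3 with e3 | e3
      · exfalso
        exact S.hq_ne (m + 1) hk 1 (by omega) m (by omega) (by omega) (by exact_mod_cast e3)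
      · exact (sub_eq_zero.1 e3).symm
    · intro l hl hne
      rw [Finset.mem_range] at hl
      rcases lt_or_gt_of_ne hne with hlt | hgt
      · rw [ih l hlt (by omega), sub_self]
      · rw [S.hq_zero l (by omega) 1 (by omega) m (by omega) (by omega)]
        simp
    · intro hc; exact absurd (Finset.mem_range.2 (by omega)) hc

theorem adj_pow_apply (n : ℕ) (y z : X) :
    (S.adj ^ n) y z ≠ 0 ↔ ∃ w : S.G.Walk y z, w.length = n := by
  classical
  have : S.adj = S.G.adjMatrix ℂ := by
    ext y z
    simp [adj, Amat, SimpleGraph.adjMatrix_apply]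
  rw [this, SimpleGraph.adjMatrix_pow_apply_eq_card_walk]
  rw [Nat.cast_ne_zero, ← Nat.pos_iff_ne_zero, Fintype.card_pos_iff]
  simp

theorem dist_le_of_E {y z y' z' : X} (h : S.E 1 y z = S.E 1 y' z') :
    S.G.dist y' z' ≤ S.G.dist y z := by
  have hp : (S.adj ^ (S.G.dist y z)) y z = (S.adj ^ (S.G.dist y z)) y' z' := by
    have := aeval_adj S (Polynomial.X ^ (S.G.dist y z))
    rw [map_pow, Polynomial.aeval_X] at this
    rw [this]
    simp only [Matrix.sum_apply, Matrix.smul_apply]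
    refine Finset.sum_congr rfl fun k hk => ?_
    rw [Finset.mem_range] at hk
    rw [E_all S h k (by omega)]
  obtain ⟨w, hw⟩ := (S.conn y z).exists_walk_length_eq_dist
  have h1 := (adj_pow_apply S _ y z).2 ⟨w, hw⟩
  rw [hp] at h1
  obtain ⟨w', hw'⟩ := (adj_pow_apply S _ _ _).1 h1
  rw [← hw']
  exact SimpleGraph.dist_le w'

theorem aeval_diagonal (p : Polynomial ℂ) (f : X → ℂ) :
    Polynomial.aeval (Matrix.diagonal f) p = Matrix.diagonal (fun y => p.eval (f y)) := by
  induction p using Polynomial.induction_on' with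
  | add p q hp hq => simp [hp, hq, Matrix.diagonal_add]
  | monomial n c =>
    rw [Polynomial.aeval_monomial, Matrix.diagonal_pow, Algebra.algebraMap_eq_smul_one,
      smul_mul_assoc, one_mul]
    ext y z
    by_cases h : y = z
    · subst h; simp
    · simp [h]

theorem Estar_mem (k : ℕ) : S.Estar x k ∈ S.Talg x := by
  obtain ⟨p, hp⟩ := (Polynomial.exists_eval_eq_iff
    (fun y : X => (Fintype.card X : ℂ) * S.E 1 x y)
    (fun y => if S.G.dist x y = k then 1 else 0)).2 (by
      intro y z h
      have h' := mul_left_cancel₀ (card_ne S) h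
      have : S.G.dist x y = S.G.dist x z :=
        le_antisymm (dist_le_of_E S h'.symm) (dist_le_of_E S h')
      simp [this])
  have : S.Estar x k = Polynomial.aeval (S.Astar x) p := by
    rw [Astar, aeval_diagonal, Estar]
    congr 1
    funext y
    exact (hp y).symm
  rw [this]
  exact Algebra.adjoin_mono (by simp) (Polynomial.aeval_mem_adjoin_singleton ℂ _)

open Classical in
/-- The dual eigenvalues. -/
def dualTheta (i : ℕ) : ℂ :=
  if h : ∃ y, S.G.dist x y = i then (Fintype.card X : ℂ) * S.E 1 x h.choose else 0

theorem half_star : Half (PZ S.D (S.Estar x)) (Matrix.toEuclideanLin (S.Astar x))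
    (Matrix.toEuclideanLin S.adj) (fun k => S.dualTheta x k.toNat) := by
  apply half_of
  · intro i _ j _
    rw [Estar, Estar, Matrix.diagonal_mul_diagonal]
    by_cases h : i = j
    · subst h; simp
    · rw [if_neg h]
      ext y z
      by_cases hyz : y = z
      · subst hyz
        by_cases h1 : S.G.dist x y = i
        · simp [h1, h]
        · simp [h1]
      · simp [hyz]
  · ext y z
    by_cases hyz : y = z
    · subst hyz
      have := S.dist_le x y
      simp [Matrix.sum_apply, Estar, Finset.sum_ite_eq]
      omega
    · simp [Matrix.sum_apply, Estar, hyz]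
  · intro i _
    rw [Estar]
    ext y z
    by_cases hyz : y = z
    · subst hyz
      simp
    · simp [hyz, Ne.symm hyz]
  · intro i _
    rw [Estar, Astar, Matrix.diagonal_mul_diagonal]
    ext y z
    by_cases hyz : y = z
    · subst hyz
      by_cases h : S.G.dist x y = i
      · have hex : ∃ y, S.G.dist x y = i := ⟨y, h⟩
        have h3 := S.hD3
        simp only [Matrix.diagonal_apply_eq, Matrix.smul_apply, if_pos h, dualTheta, dif_pos hex]
        rw [E_const S (by omega : 1 ≤ S.D) (h.trans hex.choose_spec.symm)]
        simp
      · simp [h]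
    · simp [hyz]
  · intro h _ l _ hhl
    ext y z
    simp only [Estar, Matrix.mul_diagonal, Matrix.diagonal_mul, adj, Amat, Matrix.of_apply,
      Matrix.zero_apply]
    by_cases h1 : S.G.dist x y = h
    · by_cases h2 : S.G.dist x z = l
      · by_cases h3 : S.G.dist y z = 1
        · exfalso
          have t1 := S.conn.dist_triangle (u := x) (v := y) (w := z)
          have t2 := S.conn.dist_triangle (u := x) (v := z) (w := y)
          rw [SimpleGraph.dist_comm (u := z)] at t2
          omega
        · simp [h3]
      · simp [h2]
    · simp [h1]

open scoped ComplexOrder in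
theorem tri_E {h l : ℕ} (hh : h ≤ S.D) (hl : l ≤ S.D) (hhl : h + 1 < l ∨ l + 1 < h) :
    S.E h * S.Astar x * S.E l = 0 := by
  have h3 := S.hD3
  have hAs : (S.Astar x)ᴴ = S.Astar x := by
    rw [Astar, Matrix.diagonal_conjTranspose]
    congr 1
    funext y
    have := E_star S (by omega : 1 ≤ S.D) x y
    simp only [Pi.star_apply, star_mul', this, star_natCast]
  rw [← Matrix.trace_mul_conjTranspose_self_eq_zero_iff]
  rw [Matrix.conjTranspose_mul, Matrix.conjTranspose_mul, hAs, E_herm S hh, E_herm S hl]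
  have e1 : (S.E h * S.Astar x * S.E l * (S.E l * (S.Astar x * S.E h))).trace =
      (S.E h * S.Astar x * (S.E l * S.Astar x)).trace := by
    have : S.E h * S.Astar x * S.E l * (S.E l * (S.Astar x * S.E h)) =
        (S.E h * S.Astar x * (S.E l * S.E l) * S.Astar x) * S.E h := by
      simp only [mul_assoc]
    rw [this, Matrix.trace_mul_comm, S.hEmul l hl l hl, if_pos rfl]
    simp only [← mul_assoc]
    rw [S.hEmul h hh h hh, if_pos rfl]
  rw [e1]
  have hz : S.E 1 * (Matrix.hadamard (S.E h) (S.E l)) * S.E 1 = 0 := by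
    rw [S.hKrein h hh l hl]
    rw [mul_smul_comm, smul_mul_assoc, Finset.mul_sum, Finset.sum_mul]
    rw [Finset.sum_eq_zero, smul_zero]
    intro k hk
    rw [Finset.mem_range] at hk
    rw [mul_smul_comm, S.hEmul 1 (by omega) k (by omega)]
    by_cases h1 : 1 = k
    · subst h1
      rw [S.hq_zero 1 (by omega) h hh l hl (by omega)]
      simp
    · simp [h1]
  have hzx := congrFun (congrFun hz x) x
  rw [Matrix.zero_apply] at hzx
  have : (S.E h * S.Astar x * (S.E l * S.Astar x)).trace =
      (Fintype.card X : ℂ) ^ 2 * (S.E 1 * (Matrix.hadamard (S.E h) (S.E l)) * S.E 1) x x := by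
    have e2 : ∀ (B : Matrix X X ℂ) (y w : X),
        (B * S.Astar x) y w = B y w * ((Fintype.card X : ℂ) * S.E 1 x w) := by
      intro B y w
      rw [Astar, Matrix.mul_diagonal]
    rw [Matrix.trace]
    simp only [Matrix.diag_apply, Matrix.mul_apply (M := S.E h * S.Astar x), e2]
    simp only [Matrix.mul_apply, Matrix.hadamard_apply, Finset.mul_sum, Finset.sum_mul]
    refine Finset.sum_congr rfl fun y _ => Finset.sum_congr rfl fun w _ => ?_
    rw [E_symm S (by omega : 1 ≤ S.D) y x, E_symm S hh w y]
    ring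
  rw [this, hzx, mul_zero]

theorem half_E : Half (PZ S.D S.E) (Matrix.toEuclideanLin S.adj)
    (Matrix.toEuclideanLin (S.Astar x)) (fun k => (S.θ k.toNat : ℂ)) :=
  half_of (θ := fun k => (S.θ k : ℂ)) S.hEmul S.hEsum (fun _ hi => E_herm S hi)
    (fun _ hi => E_mul_adj S hi) (fun _ hh _ hl hhl => tri_E S x hh hl hhl)

theorem isTModule_of {W : Submodule ℂ (EuclideanSpace ℂ X)}
    (ha : ∀ v ∈ W, Matrix.toEuclideanLin S.adj v ∈ W)
    (hb : ∀ v ∈ W, Matrix.toEuclideanLin (S.Astar x) v ∈ W) : S.IsTModule x W := by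
  intro B hB
  induction hB using Algebra.adjoin_induction with
  | mem B hB =>
    rcases hB with rfl | rfl
    · exact ha
    · exact hb
  | algebraMap r =>
    intro w hw
    rw [Algebra.algebraMap_eq_smul_one, map_smul, LinearMap.smul_apply, lin_one]
    exact W.smul_mem _ hw
  | add A B _ _ hA hB =>
    intro w hw
    rw [map_add, LinearMap.add_apply]
    exact W.add_mem (hA w hw) (hB w hw)
  | mul A B _ _ hA hB =>
    intro w hw
    rw [lin_mul]
    exact hA _ (hB w hw)

theorem irr_of {W : Submodule ℂ (EuclideanSpace ℂ X)} (hW : S.IsIrredTModule x W) :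
    Irr W (Matrix.toEuclideanLin S.adj) (Matrix.toEuclideanLin (S.Astar x)) where
  ha := hW.1 _ (Algebra.subset_adjoin (by simp))
  hb := hW.1 _ (Algebra.subset_adjoin (by simp))
  irr W' hle ha hb := hW.2.2 W' hle (isTModule_of S x ha hb)

theorem inv_E {W : Submodule ℂ (EuclideanSpace ℂ X)} (hW : S.IsTModule x W) (k : ℤ) :
    ∀ v ∈ W, PZ S.D S.E k v ∈ W := by
  intro v hv
  rcases PZ_cases S.D k with ⟨m, hm, rfl⟩ | hk
  · rw [PZ_nat _ hm]; exact hW _ (E_mem S x hm) _ hv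
  · rw [PZ_out _ _ hk]; exact W.zero_mem

theorem inv_Estar {W : Submodule ℂ (EuclideanSpace ℂ X)} (hW : S.IsTModule x W) (k : ℤ) :
    ∀ v ∈ W, PZ S.D (S.Estar x) k v ∈ W := by
  intro v hv
  rcases PZ_cases S.D k with ⟨m, hm, rfl⟩ | hk
  · rw [PZ_nat _ hm]; exact hW _ (Estar_mem S x m) _ hv
  · rw [PZ_out _ _ hk]; exact W.zero_mem

theorem EW_eq (W : Submodule ℂ (EuclideanSpace ℂ X)) (k : ℤ) :
    S.EW W k = Submodule.map (PZ S.D S.E k) W := by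
  rw [EW, PZ]
  split_ifs
  · rfl
  · rw [Submodule.map_zero]

theorem EstarW_eq (W : Submodule ℂ (EuclideanSpace ℂ X)) (k : ℤ) :
    S.EstarW x W k = Submodule.map (PZ S.D (S.Estar x) k) W := by
  rw [EstarW, PZ]
  split_ifs
  · rfl
  · rw [Submodule.map_zero]

theorem EV_eq (k : ℤ) : S.EV k = Submodule.map (PZ S.D S.E k) ⊤ := by
  rw [EV, PZ]
  split_ifs
  · rw [Submodule.map_top]
  · rw [Submodule.map_zero]

theorem EstarV_eq (k : ℤ) : S.EstarV x k = Submodule.map (PZ S.D (S.Estar x) k) ⊤ := by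
  rw [EstarV, PZ]
  split_ifs
  · rw [Submodule.map_top]
  · rw [Submodule.map_zero]

/-- Reindexing: `lo + k` (if `f = false`) or `lo + d - k` (if `f = true`). -/
def re (f : Bool) (lo d : ℕ) (k : ℤ) : ℤ := if f then lo + d - k else lo + k

theorem main_aux {W : Submodule ℂ (EuclideanSpace ℂ X)} (hW : S.IsIrredTModule x W)
    {ρ τ d : ℕ} (hρd : ρ + d ≤ S.D) (hτd : τ + d ≤ S.D)
    (sQ : Supp (fun k => PZ S.D (S.Estar x) (ρ + k)) W d)
    (sP : Supp (fun k => PZ S.D S.E (τ + k)) W d)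
    {h : ℕ} (hh : h ≤ d) {i j : ℕ} (hi : i ≤ S.D) (hj : j ≤ S.D) (μ ν : Bool) :
    S.Wsplit x W ρ τ d μ ν h ≤ S.tildeV x μ ν i j ↔
      (i : ℤ) - (if μ then (S.D - ρ - d : ℤ) else ρ) = h ∧
      (if ν then (S.D - τ : ℤ) else τ + d) - j = h := by
  set Q := PZ S.D (S.Estar x) with hQ
  set P := PZ S.D S.E with hP
  have HP : Half P _ _ _ := half_E S x
  have HQ : Half Q _ _ _ := half_star S x
  set Q' : ℤ → _ := fun k => Q (re μ ρ d k) with hQ'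
  set P' : ℤ → _ := fun k => P (re (!ν) τ d k) with hP'
  have HP' : ∃ θ, Half P' (Matrix.toEuclideanLin S.adj) (Matrix.toEuclideanLin (S.Astar x)) θ := by
    cases ν
    · exact ⟨_, HP.flip (τ + d)⟩
    · exact ⟨_, HP.shift τ⟩
  have HQ' : ∃ θ, Half Q' (Matrix.toEuclideanLin (S.Astar x)) (Matrix.toEuclideanLin S.adj) θ := by
    cases μ
    · exact ⟨_, HQ.shift ρ⟩
    · exact ⟨_, HQ.flip (ρ + d)⟩
  have sP' : Supp P' W d := by
    cases ν
    · exact sP.flip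
    · exact sP
  have sQ' : Supp Q' W d := by
    cases μ
    · exact sQ
    · exact sQ.flip
  obtain ⟨θ', HP'⟩ := HP'
  obtain ⟨φ', HQ'⟩ := HQ'
  have outQ : ∀ l : ℤ, ¬ ((ρ : ℤ) ≤ l ∧ l ≤ ρ + d) → ∀ v ∈ W, Q l v = 0 := by
    intro l hl v hv
    by_cases h0 : l < ρ
    · simpa using sQ.neg (l - ρ) (by omega) v hv
    · simpa using sQ.big (l - ρ) (by omega) v hv
  have outP : ∀ l : ℤ, ¬ ((τ : ℤ) ≤ l ∧ l ≤ τ + d) → ∀ v ∈ W, P l v = 0 := by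
    intro l hl v hv
    by_cases h0 : l < τ
    · simpa using sP.neg (l - τ) (by omega) v hv
    · simpa using sP.big (l - τ) (by omega) v hv
  have outQV : ∀ l : ℤ, ¬ (0 ≤ l ∧ l ≤ S.D) →
      ∀ v ∈ (⊤ : Submodule ℂ (EuclideanSpace ℂ X)), Q l v = 0 := by
    intro l hl v _
    rw [hQ, PZ_out _ _ hl]; rfl
  have outPV : ∀ l : ℤ, ¬ (0 ≤ l ∧ l ≤ S.D) →
      ∀ v ∈ (⊤ : Submodule ℂ (EuclideanSpace ℂ X)), P l v = 0 := by
    intro l hl v _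
    rw [hP, PZ_out _ _ hl]; rfl
  have eW : S.Wsplit x W ρ τ d μ ν h = W ⊓ VF Q' P' h h := by
    have f1 : ∀ v, v ∈ (if μ then ⨆ k ∈ Finset.Icc (ρ + d - h) (ρ + d), S.EstarW x W k
        else ⨆ k ∈ Finset.Icc ρ (ρ + h), S.EstarW x W k) ↔
        v ∈ W ∧ ∀ k : ℤ, (h : ℤ) < k → Q (re μ ρ d k) v = 0 := by
      intro v
      simp only [EstarW_eq]
      cases μ
      · simp only [Bool.false_eq_true, if_false]
        apply sup_mem HQ (inv_Estar S x hW.1)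
        · intro l
          simp only [re, Finset.mem_Icc]
          by_cases h1 : (ρ : ℤ) ≤ l ∧ l ≤ ρ + d
          · by_cases h2 : l ≤ ρ + h
            · exact Or.inr (Or.inl ⟨l.toNat, by omega, by omega⟩)
            · exact Or.inl ⟨l - ρ, by omega, by simp⟩
          · exact Or.inr (Or.inr (outQ l h1))
        · intro k hk n hn
          rw [Finset.mem_Icc] at hn
          simp only [re]
          simp
          omega
      · simp only [if_true]
        apply sup_mem HQ (inv_Estar S x hW.1)
        · intro l
          simp only [re, Finset.mem_Icc]
          by_cases h1 : (ρ : ℤ) ≤ l ∧ l ≤ ρ + d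
          · by_cases h2 : ρ + d - h ≤ l
            · exact Or.inr (Or.inl ⟨l.toNat, by omega, by omega⟩)
            · exact Or.inl ⟨ρ + d - l, by omega, by simp⟩
          · exact Or.inr (Or.inr (outQ l h1))
        · intro k hk n hn
          rw [Finset.mem_Icc] at hn
          simp only [re]
          simp
          omega
    have f2 : ∀ v, v ∈ (if ν then ⨆ k ∈ Finset.Icc (τ + h) (τ + d), S.EW W k
        else ⨆ k ∈ Finset.Icc τ (τ + d - h), S.EW W k) ↔
        v ∈ W ∧ ∀ k : ℤ, k < h → P (re (!ν) τ d k) v = 0 := by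
      intro v
      simp only [EW_eq]
      cases ν
      · simp only [Bool.false_eq_true, if_false]
        apply sup_mem HP (inv_E S x hW.1)
        · intro l
          simp only [re, Finset.mem_Icc]
          by_cases h1 : (τ : ℤ) ≤ l ∧ l ≤ τ + d
          · by_cases h2 : l ≤ τ + d - h
            · exact Or.inr (Or.inl ⟨l.toNat, by omega, by omega⟩)
            · exact Or.inl ⟨τ + d - l, by omega, by simp⟩
          · exact Or.inr (Or.inr (outP l h1))
        · intro k hk n hn
          rw [Finset.mem_Icc] at hn
          simp only [re]
          simp
          omega
      · simp only [if_true]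
        apply sup_mem HP (inv_E S x hW.1)
        · intro l
          simp only [re, Finset.mem_Icc]
          by_cases h1 : (τ : ℤ) ≤ l ∧ l ≤ τ + d
          · by_cases h2 : τ + h ≤ l
            · exact Or.inr (Or.inl ⟨l.toNat, by omega, by omega⟩)
            · exact Or.inl ⟨l - τ, by omega, by simp⟩
          · exact Or.inr (Or.inr (outP l h1))
        · intro k hk n hn
          rw [Finset.mem_Icc] at hn
          simp only [re]
          simp
          omega
    ext v
    rw [Wsplit, Submodule.mem_inf, f1, f2, Submodule.mem_inf, mem_VF]
    tauto
  have eV : ∀ i j : ℤ, -1 ≤ i → -1 ≤ j → i ≤ S.D → j ≤ S.D → S.Vsplit x μ ν i j =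
      VF Q' P' (i - (if μ then (S.D - ρ - d : ℤ) else ρ))
        ((if ν then (S.D - τ : ℤ) else τ + d) - j) := by
    intro i j hi1 hj1 hiD hjD
    rw [Vsplit]
    by_cases hij : 0 ≤ i ∧ 0 ≤ j
    · rw [if_pos hij]
      have f1 : ∀ v, v ∈ (if μ then ⨆ k ∈ Finset.Icc (S.D - i.toNat) S.D, S.EstarV x k
          else ⨆ k ∈ Finset.range (i.toNat + 1), S.EstarV x k) ↔
          v ∈ (⊤ : Submodule ℂ (EuclideanSpace ℂ X)) ∧
          ∀ k : ℤ, i - (if μ then (S.D - ρ - d : ℤ) else ρ) < k → Q (re μ ρ d k) v = 0 := by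
        intro v
        simp only [EstarV_eq]
        cases μ
        · simp only [Bool.false_eq_true, if_false]
          apply sup_mem HQ (W := ⊤) (fun _ _ _ => trivial)
          · intro l
            simp only [re, Finset.mem_range]
            by_cases h1 : 0 ≤ l ∧ l ≤ S.D
            · by_cases h2 : l ≤ i
              · exact Or.inr (Or.inl ⟨l.toNat, by omega, by omega⟩)
              · exact Or.inl ⟨l - ρ, by omega, by simp⟩
            · exact Or.inr (Or.inr (outQV l h1))
          · intro k hk n hn
            rw [Finset.mem_range] at hn
            simp only [re]
            simp
            omega
        · simp only [if_true]
          apply sup_mem HQ (W := ⊤) (fun _ _ _ => trivial)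
          · intro l
            simp only [re, Finset.mem_Icc]
            by_cases h1 : 0 ≤ l ∧ l ≤ S.D
            · by_cases h2 : S.D - i ≤ l
              · exact Or.inr (Or.inl ⟨l.toNat, by omega, by omega⟩)
              · exact Or.inl ⟨ρ + d - l, by omega, by simp⟩
            · exact Or.inr (Or.inr (outQV l h1))
          · intro k hk n hn
            rw [Finset.mem_Icc] at hn
            simp only [re]
            simp
            omega
      have f2 : ∀ v, v ∈ (if ν then ⨆ k ∈ Finset.Icc (S.D - j.toNat) S.D, S.EV k
          else ⨆ k ∈ Finset.range (j.toNat + 1), S.EV k) ↔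
          v ∈ (⊤ : Submodule ℂ (EuclideanSpace ℂ X)) ∧
          ∀ k : ℤ, k < (if ν then (S.D - τ : ℤ) else τ + d) - j → P (re (!ν) τ d k) v = 0 := by
        intro v
        simp only [EV_eq]
        cases ν
        · simp only [Bool.false_eq_true, if_false]
          apply sup_mem HP (W := ⊤) (fun _ _ _ => trivial)
          · intro l
            simp only [re, Finset.mem_range]
            by_cases h1 : 0 ≤ l ∧ l ≤ S.D
            · by_cases h2 : l ≤ j
              · exact Or.inr (Or.inl ⟨l.toNat, by omega, by omega⟩)
              · exact Or.inl ⟨τ + d - l, by omega, by simp⟩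
            · exact Or.inr (Or.inr (outPV l h1))
          · intro k hk n hn
            rw [Finset.mem_range] at hn
            simp only [re]
            simp
            omega
        · simp only [if_true]
          apply sup_mem HP (W := ⊤) (fun _ _ _ => trivial)
          · intro l
            simp only [re, Finset.mem_Icc]
            by_cases h1 : 0 ≤ l ∧ l ≤ S.D
            · by_cases h2 : S.D - j ≤ l
              · exact Or.inr (Or.inl ⟨l.toNat, by omega, by omega⟩)
              · exact Or.inl ⟨l - τ, by omega, by simp⟩
            · exact Or.inr (Or.inr (outPV l h1))
          · intro k hk n hn
            rw [Finset.mem_Icc] at hn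
            simp only [re]
            simp
            omega
      ext v
      have g1 := f1 v
      have g2 := f2 v
      rw [Submodule.mem_inf, g1, g2, mem_VF]
      simp only [Submodule.mem_top, true_and]
      exact Iff.rfl
    · rw [if_neg hij]
      symm
      rw [eq_bot_iff]
      intro v hv
      rw [mem_VF] at hv
      rw [Submodule.mem_bot]
      by_cases hi0 : 0 ≤ i
      · apply HP'.eq_zero
        intro k
        by_cases hr : 0 ≤ re (!ν) τ d k ∧ re (!ν) τ d k ≤ S.D
        · apply hv.2
          cases ν <;> simp [re] at hr ⊢ <;> omega
        · exact outPV _ hr v trivial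
      · apply HQ'.eq_zero
        intro k
        by_cases hr : 0 ≤ re μ ρ d k ∧ re μ ρ d k ≤ S.D
        · apply hv.1
          cases μ <;> simp [re] at hr ⊢ <;> omega
        · exact outQV _ hr v trivial
  rw [eW, tildeV, eV i j (by omega) (by omega) (by omega) (by omega),
    eV (i - 1) j (by omega) (by omega) (by omega) (by omega),
    eV i (j - 1) (by omega) (by omega) (by omega) (by omega), sub_right_comm (i : ℤ) 1, ← sub_add,
    core HP' HQ' (irr_of S x hW) sP' sQ' (by omega) (by omega)]

end concretePart

end QPolyDRG

open QPolyDRG in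
/-- For an irreducible `T`-module `W` with endpoint `ρ`, dual endpoint `τ`, diameter `d`,
and `0 ≤ h ≤ d`, `0 ≤ i, j ≤ D`:
`W^{↓↓}_h ⊆ Ṽ^{↓↓}_{i,j}` iff `i = ρ + h` and `j = τ + d - h`;
`W^{↑↓}_h ⊆ Ṽ^{↑↓}_{i,j}` iff `i = D - ρ - d + h` and `j = τ + d - h`;
`W^{↓↑}_h ⊆ Ṽ^{↓↑}_{i,j}` iff `i = ρ + h` and `j = D - τ - h`;
`W^{↑↑}_h ⊆ Ṽ^{↑↑}_{i,j}` iff `i = D - ρ - d + h` and `j = D - τ - h`. -/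
theorem drg_tmodule_split_in_tildeV {X : Type*} [Fintype X] [DecidableEq X]
    (S : QPolyDRG X) (x : X)
    (W : Submodule ℂ (EuclideanSpace ℂ X)) (hW : S.IsIrredTModule x W)
    (ρ τ d : ℕ)
    (hρ : IsLeast {i : ℕ | i ≤ S.D ∧ S.EstarW x W i ≠ ⊥} ρ)
    (hτ : IsLeast {i : ℕ | i ≤ S.D ∧ S.EW W i ≠ ⊥} τ)
    (hd : d + 1 = Set.ncard {i : ℕ | i ≤ S.D ∧ S.EstarW x W i ≠ ⊥}) :
    ∀ h : ℕ, h ≤ d → ∀ i : ℕ, i ≤ S.D → ∀ j : ℕ, j ≤ S.D →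
      (S.Wsplit x W ρ τ d false false h ≤ S.tildeV x false false i j ↔
        (i : ℤ) = ρ + h ∧ (j : ℤ) = τ + d - h) ∧
      (S.Wsplit x W ρ τ d true false h ≤ S.tildeV x true false i j ↔
        (i : ℤ) = S.D - ρ - d + h ∧ (j : ℤ) = τ + d - h) ∧
      (S.Wsplit x W ρ τ d false true h ≤ S.tildeV x false true i j ↔
        (i : ℤ) = ρ + h ∧ (j : ℤ) = S.D - τ - h) ∧
      (S.Wsplit x W ρ τ d true true h ≤ S.tildeV x true true i j ↔
        (i : ℤ) = S.D - ρ - d + h ∧ (j : ℤ) = S.D - τ - h) := by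
  have HP := half_E S x
  have HQ := half_star S x
  have hI := irr_of S x hW
  have eQ : {i : ℕ | i ≤ S.D ∧ S.EstarW x W i ≠ ⊥} =
      {i : ℕ | i ≤ S.D ∧ ∃ v ∈ W, PZ S.D (S.Estar x) (i : ℤ) v ≠ 0} := by
    ext i
    simp only [Set.mem_setOf_eq, EstarW_eq, map_ne_bot]
  have eP : {i : ℕ | i ≤ S.D ∧ S.EW W i ≠ ⊥} =
      {i : ℕ | i ≤ S.D ∧ ∃ v ∈ W, PZ S.D S.E (i : ℤ) v ≠ 0} := by
    ext i
    simp only [Set.mem_setOf_eq, EW_eq, map_ne_bot]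
  rw [eQ] at hρ hd
  rw [eP] at hτ
  obtain ⟨d1, hd1, sQ, hc⟩ := supp_of HQ hI.swap (inv_Estar S x hW.1) (PZ_out _) hρ
  obtain ⟨d2, hd2, sP, -⟩ := supp_of HP hI (inv_E S x hW.1) (PZ_out _) hτ
  obtain rfl : d = d1 := by omega
  obtain rfl : d2 = d := by
    exact_mod_cast diam_eq (HP.shift τ) (HQ.shift ρ) hI sP sQ
  intro h hh i hi j hj
  have key := main_aux S x hW hd1 hd2 sQ sP hh hi hj
  refine ⟨(key false false).trans ?_, (key true false).trans ?_, (key false true).trans ?_,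
    (key true true).trans ?_⟩
  all_goals
    simp only [Bool.false_eq_true, if_false, if_true]
    omega

end
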